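/- One has t*(4) − 2(t*(3,1) + t*(2,2)) + 4·t*(2,1,1) = (2/3)·t(2)² + 2·t(2)·log²(2), where t(2) = Σ_{m ≥ 1 odd} 1/m² = π²/8. -/

import Mathlib

/-- Multiple t-value of level `N` with residue `a`:
`t_{N,a}(k) = Σ_{m₁ > ⋯ > mₙ > 0, mᵢ ≡ a (mod N)} 1/(m₁^{k₁} ⋯ mₙ^{kₙ})`. -/
noncomputable def tv (N a : ℕ) (k : List ℕ) : ℝ :=
  ∑' m : {f : Fin k.length → ℕ // StrictAnti f ∧ ∀ i, 0 < f i ∧ f i % N = a % N},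
    ∏ i : Fin k.length, ((m.1 i : ℝ) ^ k.get i)⁻¹

/-- Multiple t-star value of level `N` with residue `a`:
`t*_{N,a}(k) = Σ_{m₁ ≥ ⋯ ≥ mₙ > 0, mᵢ ≡ a (mod N)} 1/(m₁^{k₁} ⋯ mₙ^{kₙ})`. -/
noncomputable def tsv (N a : ℕ) (k : List ℕ) : ℝ :=
  ∑' m : {f : Fin k.length → ℕ // Antitone f ∧ ∀ i, 0 < f i ∧ f i % N = a % N},
    ∏ i : Fin k.length, ((m.1 i : ℝ) ^ k.get i)⁻¹

/-- The sum `1 + 1/3 + ⋯ + 1/(2n-1)` of the first `n` odd reciprocals. -/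
noncomputable def oddHarmonic (n : ℕ) : ℝ := ∑ i ∈ Finset.range n, 1 / (2 * (i : ℝ) + 1)

/-- The kernel `m/(m² - 4k²)` at the odd number `m = 2n+1`. -/
noncomputable def oddKernel (k n : ℕ) : ℝ :=
  (2 * (n : ℝ) + 1) / ((2 * (n : ℝ) + 1) ^ 2 - 4 * (k : ℝ) ^ 2)

lemma odd_sub_ne_zero (n k : ℕ) : 2 * (n : ℝ) + 1 - 2 * k ≠ 0 := by
  intro h
  have h' : 2 * (n : ℤ) + 1 - 2 * k = 0 := by exact_mod_cast h
  omega

lemma odd_add_ne_zero (n k : ℕ) : 2 * (n : ℝ) + 1 + 2 * k ≠ 0 := by positivity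

lemma odd_sq_sub_ne_zero (n k : ℕ) : (2 * (n : ℝ) + 1) ^ 2 - 4 * (k : ℝ) ^ 2 ≠ 0 := by
  have := mul_ne_zero (odd_sub_ne_zero n k) (odd_add_ne_zero n k)
  intro h
  apply this
  linear_combination h

lemma oddHarmonic_succ (n : ℕ) :
    oddHarmonic (n + 1) = oddHarmonic n + 1 / (2 * (n : ℝ) + 1) := by
  simp [oddHarmonic, Finset.sum_range_succ]

lemma oddKernel_eq (k n : ℕ) :
    oddKernel k n =
      (1 / (2 * (n : ℝ) + 1 - 2 * k) + 1 / (2 * (n : ℝ) + 1 + 2 * k)) / 2 := by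
  have h1 := odd_sub_ne_zero n k
  have h2 := odd_add_ne_zero n k
  have h3 := odd_sq_sub_ne_zero n k
  rw [oddKernel]
  field_simp
  ring

open Filter Topology

lemma tendsto_one_div_two_mul_add (c : ℝ) :
    Tendsto (fun N : ℕ => 1 / (2 * (N : ℝ) + c)) atTop (𝓝 0) := by
  simp only [one_div]
  refine Tendsto.inv_tendsto_atTop ?_
  exact tendsto_atTop_add_const_right _ _
    (tendsto_natCast_atTop_atTop.const_mul_atTop (by norm_num))

lemma HasSum.congr_both {α : Type*} {f g : α → ℝ} {a b : ℝ} (h : HasSum f a)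
    (hfg : ∀ n, g n = f n) (hab : b = a) : HasSum g b := by
  rwa [funext hfg, hab]

/-! ### Sums over odd numbers -/

lemma hasSum_odd_pow {p : ℕ} {z : ℝ} (h : HasSum (fun n : ℕ => 1 / (n : ℝ) ^ p) z) :
    HasSum (fun n : ℕ => 1 / (2 * (n : ℝ) + 1) ^ p) (z - z / 2 ^ p) := by
  set f : ℕ → ℝ := fun n => 1 / (n : ℝ) ^ p with hf
  have he : HasSum (fun n => f (2 * n)) (z / 2 ^ p) := by
    refine (h.div_const (2 ^ p)).congr_both (fun n => ?_) rfl
    simp only [hf]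
    push_cast
    rw [mul_pow, ← div_div, div_right_comm]
  have ho : Summable (fun n => f (2 * n + 1)) :=
    h.summable.comp_injective (i := fun n : ℕ => 2 * n + 1)
      (fun a b hab => by simpa using hab)
  have hs : z / 2 ^ p + ∑' n, f (2 * n + 1) = z :=
    (HasSum.even_add_odd (f := f) he ho.hasSum).unique h
  refine ho.hasSum.congr_both (fun n => ?_) (by linarith)
  simp [hf]

lemma hasSum_odd_sq : HasSum (fun n : ℕ => 1 / (2 * (n : ℝ) + 1) ^ 2) (Real.pi ^ 2 / 8) :=
  (hasSum_odd_pow hasSum_zeta_two).congr_both (fun _ => rfl) (by ring)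

lemma hasSum_odd_pow_four :
    HasSum (fun n : ℕ => 1 / (2 * (n : ℝ) + 1) ^ 4) (Real.pi ^ 4 / 96) :=
  (hasSum_odd_pow hasSum_zeta_four).congr_both (fun _ => rfl) (by ring)

lemma exists_hasSum_shifted_sq (k : ℕ) : ∃ a b : ℝ,
    HasSum (fun n : ℕ => 1 / (2 * (n : ℝ) + 1 - 2 * k) ^ 2) a ∧
    HasSum (fun n : ℕ => 1 / (2 * (n : ℝ) + 1 + 2 * k) ^ 2) b ∧ a + b = Real.pi ^ 2 / 4 := by
  induction k with
  | zero =>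
    refine ⟨Real.pi ^ 2 / 8, Real.pi ^ 2 / 8, ?_, ?_, by ring⟩ <;> simpa using hasSum_odd_sq
  | succ k ih =>
    obtain ⟨a, b, ha, hb, hab⟩ := ih
    refine ⟨a + 1 / (2 * (k : ℝ) + 1) ^ 2, b - 1 / (2 * (k : ℝ) + 1) ^ 2, ?_, ?_, by linarith⟩
    · rw [← hasSum_nat_add_iff' 1]
      refine ha.congr_both (fun n => ?_) ?_
      · push_cast; congr 2; ring
      · have : (2 * (0 : ℝ) + 1 - 2 * (k + 1)) ^ 2 = (2 * (k : ℝ) + 1) ^ 2 := by ring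
        simp only [Finset.sum_range_one, Nat.cast_zero, Nat.cast_add, Nat.cast_one, this]
        ring
    · rw [← hasSum_nat_add_iff' 1] at hb
      refine hb.congr_both (fun n => ?_) ?_
      · push_cast; congr 2; ring
      · simp [add_comm]

lemma tendsto_sum_telescope (k : ℕ) :
    Tendsto (fun N => ∑ n ∈ Finset.range N,
      (1 / (2 * (n : ℝ) + 1 - 2 * k) - 1 / (2 * (n : ℝ) + 1 + 2 * k))) atTop (𝓝 0) := by
  induction k with
  | zero => simp
  | succ k ih =>
    have key : ∀ N : ℕ, ∑ n ∈ Finset.range N,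
        (1 / (2 * (n : ℝ) + 1 - 2 * (k + 1 : ℕ)) - 1 / (2 * (n : ℝ) + 1 + 2 * (k + 1 : ℕ))) =
        ∑ n ∈ Finset.range N,
          (1 / (2 * (n : ℝ) + 1 - 2 * k) - 1 / (2 * (n : ℝ) + 1 + 2 * k)) -
        (1 / (2 * (N : ℝ) + (-1 - 2 * k)) + 1 / (2 * (N : ℝ) + (1 + 2 * k))) := by
      intro N
      induction N with
      | zero =>
        have : (2 * ((0 : ℕ) : ℝ) + (-1 - 2 * k)) = -(2 * ((0 : ℕ) : ℝ) + (1 + 2 * k)) := by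
          push_cast; ring
        rw [this, one_div_neg_eq_neg_one_div]
        simp
      | succ N ihN =>
        rw [Finset.sum_range_succ, ihN, Finset.sum_range_succ]
        have e1 : 2 * (N : ℝ) + 1 - 2 * (k + 1 : ℕ) = 2 * (N : ℝ) + (-1 - 2 * k) := by
          push_cast; ring
        have e2 : 2 * (N : ℝ) + 1 + 2 * (k + 1 : ℕ) = 2 * (N + 1 : ℕ) + (1 + 2 * k) := by
          push_cast; ring
        have e3 : 2 * (N : ℝ) + 1 - 2 * k = 2 * (N + 1 : ℕ) + (-1 - 2 * k) := by
          push_cast; ring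
        rw [e1, e2, e3, ← add_assoc]
        ring
    simp only [key]
    simpa using ih.sub ((tendsto_one_div_two_mul_add (-1 - 2 * k)).add
      (tendsto_one_div_two_mul_add (1 + 2 * k)))

lemma summable_shifted_mul (k : ℕ) : Summable (fun n : ℕ =>
    1 / (2 * (n : ℝ) + 1 - 2 * k) * (1 / (2 * (n : ℝ) + 1 + 2 * k))) := by
  obtain ⟨a, b, ha, hb, -⟩ := exists_hasSum_shifted_sq k
  refine Summable.of_norm_bounded (ha.summable.add hb.summable) fun n => ?_
  have h1 : 1 / (2 * (n : ℝ) + 1 - 2 * k) ^ 2 = (1 / (2 * (n : ℝ) + 1 - 2 * k)) ^ 2 := by simp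
  have h2 : 1 / (2 * (n : ℝ) + 1 + 2 * k) ^ 2 = (1 / (2 * (n : ℝ) + 1 + 2 * k)) ^ 2 := by simp
  rw [h1, h2, Real.norm_eq_abs, abs_le]
  generalize 1 / (2 * (n : ℝ) + 1 - 2 * k) = x
  generalize 1 / (2 * (n : ℝ) + 1 + 2 * k) = y
  constructor <;> nlinarith [sq_nonneg (x + y), sq_nonneg (x - y)]

lemma hasSum_shifted_mul {k : ℕ} (hk : k ≠ 0) : HasSum (fun n : ℕ =>
    1 / (2 * (n : ℝ) + 1 - 2 * k) * (1 / (2 * (n : ℝ) + 1 + 2 * k))) 0 := by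
  rw [(summable_shifted_mul k).hasSum_iff_tendsto_nat]
  have hk' : (k : ℝ) ≠ 0 := by exact_mod_cast hk
  have := (tendsto_sum_telescope k).const_mul (1 / (4 * (k : ℝ)))
  rw [mul_zero] at this
  refine this.congr fun N => ?_
  rw [Finset.mul_sum]
  refine Finset.sum_congr rfl fun n _ => ?_
  rw [div_sub_div _ _ (odd_sub_ne_zero n k) (odd_add_ne_zero n k), one_div_mul_one_div,
    one_div_mul_eq_div, div_div, div_eq_div_iff]
  · ring
  · exact mul_ne_zero (mul_ne_zero (odd_sub_ne_zero n k) (odd_add_ne_zero n k)) (by simpa)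
  · exact mul_ne_zero (odd_sub_ne_zero n k) (odd_add_ne_zero n k)

/-! ### Orthogonality of the kernels -/

lemma hasSum_oddKernel_mul_self {k : ℕ} (hk : k ≠ 0) :
    HasSum (fun n => oddKernel k n * oddKernel k n) (Real.pi ^ 2 / 16) := by
  obtain ⟨a, b, ha, hb, hab⟩ := exists_hasSum_shifted_sq k
  have := ((ha.add hb).div_const 4).add ((hasSum_shifted_mul hk).div_const 2)
  rw [hab] at this
  refine this.congr_both (fun n => ?_) (by ring)
  rw [oddKernel_eq, ← one_div_pow, ← one_div_pow]
  ring

lemma oddKernel_zero (n : ℕ) : oddKernel 0 n = 1 / (2 * (n : ℝ) + 1) := by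
  have : 2 * (n : ℝ) + 1 ≠ 0 := by positivity
  rw [oddKernel]
  field_simp
  simp

lemma hasSum_oddKernel_zero_mul_self :
    HasSum (fun n => oddKernel 0 n * oddKernel 0 n) (Real.pi ^ 2 / 8) := by
  refine hasSum_odd_sq.congr_both (fun n => ?_) rfl
  rw [oddKernel_zero, ← one_div_pow, sq]

lemma hasSum_oddKernel_mul {k l : ℕ} (hkl : k ≠ l) :
    HasSum (fun n => oddKernel k n * oddKernel l n) 0 := by
  have hsum : ∀ j : ℕ, HasSum (fun n : ℕ =>
      4 * (j : ℝ) ^ 2 * (1 / (2 * (n : ℝ) + 1 - 2 * j) * (1 / (2 * (n : ℝ) + 1 + 2 * j)))) 0 := by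
    intro j
    rcases eq_or_ne j 0 with rfl | hj
    · simp
    · simpa using (hasSum_shifted_mul hj).mul_left (4 * (j : ℝ) ^ 2)
  have hd : 4 * (k : ℝ) ^ 2 - 4 * (l : ℝ) ^ 2 ≠ 0 := by
    intro h
    apply hkl
    have h' : (k : ℝ) ^ 2 = (l : ℝ) ^ 2 := by linarith
    exact_mod_cast (pow_left_inj₀ (Nat.cast_nonneg k) (Nat.cast_nonneg l) two_ne_zero).1 h'
  have := ((hsum k).sub (hsum l)).div_const (4 * (k : ℝ) ^ 2 - 4 * (l : ℝ) ^ 2)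
  refine this.congr_both (fun n => ?_) (by simp)
  · have hd' : (k : ℝ) ^ 2 - (l : ℝ) ^ 2 ≠ 0 := fun h => hd (by linear_combination 4 * h)
    have h3 := odd_sq_sub_ne_zero n k
    have h4 := odd_sq_sub_ne_zero n l
    have e : ∀ j : ℕ, 1 / (2 * (n : ℝ) + 1 - 2 * j) * (1 / (2 * (n : ℝ) + 1 + 2 * j)) =
        1 / ((2 * (n : ℝ) + 1) ^ 2 - 4 * (j : ℝ) ^ 2) := by
      intro j
      rw [one_div_mul_one_div]
      congr 1
      ring
    rw [e, e, oddKernel, oddKernel]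
    field_simp
    ring

/-! ### Expansion of the odd harmonic numbers in the kernels -/

lemma oddHarmonic_eq_harmonic (K : ℕ) :
    oddHarmonic K = (harmonic (2 * K) : ℝ) - (harmonic K : ℝ) / 2 := by
  induction K with
  | zero => simp [oddHarmonic]
  | succ K ih =>
    rw [oddHarmonic_succ, ih, show 2 * (K + 1) = 2 * K + 1 + 1 by ring, harmonic_succ,
      harmonic_succ, harmonic_succ]
    push_cast
    field_simp
    ring

lemma tendsto_harmonic_two_mul_sub :
    Tendsto (fun K : ℕ => (harmonic (2 * K) : ℝ) - (harmonic K : ℝ)) atTop (𝓝 (Real.log 2)) := by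
  have h := Real.tendsto_harmonic_sub_log
  have h2 := h.comp (tendsto_id.const_mul_atTop' (show 0 < 2 by norm_num))
  have := (h2.sub h).add_const (Real.log 2)
  simp only [sub_self, zero_add] at this
  refine this.congr' ?_
  filter_upwards [eventually_gt_atTop 0] with K hK
  have hK' : (K : ℝ) ≠ 0 := by positivity
  simp only [Function.comp, id]
  push_cast
  rw [Real.log_mul two_ne_zero hK']
  ring

lemma tendsto_sum_mul_oddKernel (n : ℕ) :
    Tendsto (fun K => ∑ k ∈ Finset.range K,
      (2 * (n : ℝ) + 1) * (1 / ((k : ℝ) + 1) * oddKernel (k + 1) n)) atTop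
      (𝓝 (oddHarmonic n + oddHarmonic (n + 1) - 2 * Real.log 2)) := by
  have hterm : ∀ n k : ℕ, (2 * (n : ℝ) + 1) * (1 / ((k : ℝ) + 1) * oddKernel (k + 1) n) =
      1 / ((k : ℝ) + 1) + 1 / (2 * (n : ℝ) + 1 - 2 * ((k + 1 : ℕ) : ℝ)) -
        1 / (2 * (n : ℝ) + 1 + 2 * ((k + 1 : ℕ) : ℝ)) := by
    intro n k
    have h1 := odd_sub_ne_zero n (k + 1)
    have h2 := odd_add_ne_zero n (k + 1)
    have h3 : (k : ℝ) + 1 ≠ 0 := by positivity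
    rw [oddKernel_eq]
    push_cast at *
    field_simp
    ring
  simp only [hterm]
  induction n with
  | zero =>
    have key : ∀ K : ℕ, ∑ k ∈ Finset.range K,
        (1 / ((k : ℝ) + 1) + 1 / (2 * ((0 : ℕ) : ℝ) + 1 - 2 * ((k + 1 : ℕ) : ℝ)) -
        1 / (2 * ((0 : ℕ) : ℝ) + 1 + 2 * ((k + 1 : ℕ) : ℝ))) =
        1 - 1 / (2 * (K : ℝ) + 1) -
          2 * ((harmonic (2 * K) : ℝ) - (harmonic K : ℝ)) := by
      intro K
      have : ∑ k ∈ Finset.range K,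
        (1 / ((k : ℝ) + 1) + 1 / (2 * ((0 : ℕ) : ℝ) + 1 - 2 * ((k + 1 : ℕ) : ℝ)) -
        1 / (2 * ((0 : ℕ) : ℝ) + 1 + 2 * ((k + 1 : ℕ) : ℝ))) =
        1 - 1 / (2 * (K : ℝ) + 1) + harmonic K - 2 * oddHarmonic K := by
        induction K with
        | zero => simp [oddHarmonic]
        | succ K ih =>
          have e : 2 * ((0 : ℕ) : ℝ) + 1 - 2 * ((K + 1 : ℕ) : ℝ) = -(2 * (K : ℝ) + 1) := by
            push_cast; ring
          rw [Finset.sum_range_succ, ih, oddHarmonic_succ, harmonic_succ, e,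
            one_div_neg_eq_neg_one_div]
          push_cast
          ring
      rw [this, oddHarmonic_eq_harmonic]
      ring
    simp only [key]
    have := ((tendsto_one_div_two_mul_add 1).const_sub 1).sub
      (tendsto_harmonic_two_mul_sub.const_mul 2)
    simpa [oddHarmonic] using this
  | succ n ih =>
    have key : ∀ K : ℕ, ∑ k ∈ Finset.range K,
        (1 / ((k : ℝ) + 1) + 1 / (2 * ((n + 1 : ℕ) : ℝ) + 1 - 2 * ((k + 1 : ℕ) : ℝ)) -
        1 / (2 * ((n + 1 : ℕ) : ℝ) + 1 + 2 * ((k + 1 : ℕ) : ℝ))) =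
        ∑ k ∈ Finset.range K,
        (1 / ((k : ℝ) + 1) + 1 / (2 * (n : ℝ) + 1 - 2 * ((k + 1 : ℕ) : ℝ)) -
        1 / (2 * (n : ℝ) + 1 + 2 * ((k + 1 : ℕ) : ℝ))) +
        (1 / (2 * (n : ℝ) + 1) + 1 / (2 * (n : ℝ) + 3) + 1 / (2 * (K : ℝ) + (-2 * n - 1)) -
          1 / (2 * (K : ℝ) + (2 * n + 3))) := by
      intro K
      induction K with
      | zero =>
        have : (2 * ((0 : ℕ) : ℝ) + (-2 * n - 1)) = -(2 * (n : ℝ) + 1) := by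
          push_cast; ring
        rw [this, one_div_neg_eq_neg_one_div]
        simp
      | succ K ihK =>
        have e1 : 2 * ((n + 1 : ℕ) : ℝ) + 1 - 2 * ((K + 1 : ℕ) : ℝ) =
          -(2 * (K : ℝ) + (-2 * n - 1)) := by push_cast; ring
        have e2 : 2 * (n : ℝ) + 1 - 2 * ((K + 1 : ℕ) : ℝ) =
          -(2 * ((K + 1 : ℕ) : ℝ) + (-2 * n - 1)) := by push_cast; ring
        rw [Finset.sum_range_succ, ihK, Finset.sum_range_succ, e1, e2,
          one_div_neg_eq_neg_one_div, one_div_neg_eq_neg_one_div]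
        have e3 : 2 * ((n + 1 : ℕ) : ℝ) + 1 + 2 * ((K + 1 : ℕ) : ℝ) =
          2 * ((K + 1 : ℕ) : ℝ) + (2 * n + 3) := by push_cast; ring
        have e4 : 2 * (n : ℝ) + 1 + 2 * ((K + 1 : ℕ) : ℝ) = 2 * (K : ℝ) + (2 * n + 3) := by
          push_cast; ring
        rw [e3, e4]
        ring
    simp only [key]
    have := ih.add (((tendsto_one_div_two_mul_add (-2 * n - 1)).const_add
      (1 / (2 * (n : ℝ) + 1) + 1 / (2 * (n : ℝ) + 3))).sub
        (tendsto_one_div_two_mul_add (2 * n + 3)))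
    convert this using 2
    rw [oddHarmonic_succ (n + 1), oddHarmonic_succ n]
    push_cast
    ring

/-! ### Parseval -/

lemma exists_hasSum_of_pairwise_orthogonal {E : Type*} [NormedAddCommGroup E]
    [InnerProductSpace ℝ E] [CompleteSpace E] {v : ℕ → E}
    (hv : Pairwise fun i j => inner ℝ (v i) (v j) = 0) {s : ℝ}
    (hs : HasSum (fun i => inner ℝ (v i) (v i)) s) :
    ∃ x, HasSum v x ∧ inner ℝ x x = s := by
  have hV : OrthogonalFamily ℝ (fun i => (ℝ ∙ v i : Submodule ℝ E))
      fun i => (ℝ ∙ v i : Submodule ℝ E).subtypeₗᵢ := by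
    intro i j hij a b
    obtain ⟨c, hc⟩ := Submodule.mem_span_singleton.1 a.2
    obtain ⟨d, hd⟩ := Submodule.mem_span_singleton.1 b.2
    simp [← hc, ← hd, inner_smul_left, inner_smul_right, hv hij]
  have hsum : Summable v := by
    refine (hV.summable_iff_norm_sq_summable
      (fun i => ⟨v i, Submodule.mem_span_singleton_self (v i)⟩)).2 ?_
    simpa [real_inner_self_eq_norm_sq] using hs.summable
  obtain ⟨x, hx⟩ := hsum
  have hxv : ∀ i, inner ℝ x (v i) = inner ℝ (v i) (v i) := by
    intro i
    have h1 := hx.mapL (innerSL ℝ (v i))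
    have h2 : HasSum (fun j => innerSL ℝ (v i) (v j)) (innerSL ℝ (v i) (v i)) :=
      hasSum_single i fun j hj => hv hj.symm
    rw [real_inner_comm]
    exact h1.unique h2
  refine ⟨x, hx, ?_⟩
  have h3 := hx.mapL (innerSL ℝ x)
  simp only [innerSL_apply_apply, hxv] at h3
  exact h3.unique hs

/-- The kernel `oddKernel k` as a square summable sequence. -/
noncomputable def oddKernelLp (k : ℕ) : lp (fun _ : ℕ => ℝ) 2 :=
  ⟨oddKernel k, by
    refine memℓp_gen ?_
    have : Summable fun n => oddKernel k n * oddKernel k n := by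
      rcases eq_or_ne k 0 with rfl | hk
      · exact hasSum_oddKernel_zero_mul_self.summable
      · exact (hasSum_oddKernel_mul_self hk).summable
    simpa [sq] using this⟩

lemma inner_oddKernelLp {k l : ℕ} {s : ℝ}
    (h : HasSum (fun n => oddKernel k n * oddKernel l n) s) :
    inner ℝ (oddKernelLp k) (oddKernelLp l) = s := by
  refine (lp.hasSum_inner (𝕜 := ℝ) (oddKernelLp k) (oddKernelLp l)).unique ?_
  simpa [oddKernelLp, mul_comm] using h

/-- Coefficients of the sequence `n ↦ (oddHarmonic n + oddHarmonic (n + 1))/(2n+1)` with respect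
to the orthogonal kernels `oddKernel k`. -/
noncomputable def oddCoeff (k : ℕ) : ℝ := if k = 0 then 2 * Real.log 2 else 1 / (k : ℝ)

theorem hasSum_oddHarmonic_add_sq :
    HasSum (fun n : ℕ => ((oddHarmonic n + oddHarmonic (n + 1)) / (2 * (n : ℝ) + 1)) ^ 2)
      (Real.pi ^ 2 / 2 * Real.log 2 ^ 2 + Real.pi ^ 4 / 96) := by
  have horth : Pairwise fun i j => inner ℝ (oddCoeff i • oddKernelLp i)
      (oddCoeff j • oddKernelLp j) = 0 := by
    intro i j hij
    simp [inner_smul_left, inner_smul_right, inner_oddKernelLp (hasSum_oddKernel_mul hij)]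
  have hnorm : HasSum (fun i => inner ℝ (oddCoeff i • oddKernelLp i)
      (oddCoeff i • oddKernelLp i)) (Real.pi ^ 2 / 2 * Real.log 2 ^ 2 + Real.pi ^ 4 / 96) := by
    rw [← hasSum_nat_add_iff' 1]
    have hz := (hasSum_nat_add_iff' 1).2 hasSum_zeta_two
    refine (hz.mul_right (Real.pi ^ 2 / 16)).congr_both (fun n => ?_) ?_
    · rw [inner_smul_left, inner_smul_right,
        inner_oddKernelLp (hasSum_oddKernel_mul_self n.succ_ne_zero)]
      simp only [oddCoeff, n.succ_ne_zero, if_false, conj_trivial]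
      rw [← one_div_pow]
      ring
    · rw [Finset.sum_range_one, inner_smul_left, inner_smul_right,
        inner_oddKernelLp hasSum_oddKernel_zero_mul_self]
      simp only [oddCoeff, if_true, conj_trivial, Finset.sum_range_one]
      norm_num
      ring
  obtain ⟨x, hx, hxx⟩ := exists_hasSum_of_pairwise_orthogonal horth hnorm
  have hcoord : ∀ n, x n = (oddHarmonic n + oddHarmonic (n + 1)) / (2 * (n : ℝ) + 1) := by
    intro n
    have hm : 2 * (n : ℝ) + 1 ≠ 0 := by positivity
    have h1 : HasSum (fun k => oddCoeff k * oddKernel k n) (x n) :=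
      hx.mapL (lp.evalCLM ℝ (fun _ : ℕ => ℝ) 2 n)
    have h2 := ((hasSum_nat_add_iff' 1).2 h1).mul_left (2 * (n : ℝ) + 1)
    have h3 := h2.tendsto_sum_nat
    have h4 := tendsto_sum_mul_oddKernel n
    have h5 := tendsto_nhds_unique h3 (h4.congr fun K => Finset.sum_congr rfl fun k _ => by
      simp [oddCoeff])
    simp only [Finset.sum_range_one, oddCoeff, oddKernel_zero, if_true] at h5
    field_simp at h5 ⊢
    linarith
  have := lp.hasSum_inner (𝕜 := ℝ) x x
  rw [hxx] at this
  refine this.congr_both (fun n => ?_) rfl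
  rw [real_inner_self_eq_norm_sq, Real.norm_eq_abs, sq_abs, hcoord]

lemma oddHarmonic_nonneg (n : ℕ) : 0 ≤ oddHarmonic n :=
  Finset.sum_nonneg fun i _ => by positivity

/-- The complete homogeneous sum of degree two in the odd reciprocals, through power sums. -/
lemma sum_oddHarmonic_div (n : ℕ) :
    ∑ j ∈ Finset.range n, 1 / (2 * (j : ℝ) + 1) * oddHarmonic (j + 1) =
      (oddHarmonic n ^ 2 + ∑ j ∈ Finset.range n, 1 / (2 * (j : ℝ) + 1) ^ 2) / 2 := by
  induction n with
  | zero => simp [oddHarmonic]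
  | succ n ih =>
    rw [Finset.sum_range_succ, Finset.sum_range_succ, ih, oddHarmonic_succ, ← one_div_pow]
    ring

lemma sum_odd_sq_le (n : ℕ) :
    ∑ j ∈ Finset.range n, 1 / (2 * (j : ℝ) + 1) ^ 2 ≤ oddHarmonic n ^ 2 := by
  simp only [← one_div_pow]
  exact Finset.sum_sq_le_sq_sum_of_nonneg fun i _ => by positivity

lemma summable_oddHarmonic_sq :
    Summable fun n : ℕ => 1 / (2 * (n : ℝ) + 1) ^ 2 * oddHarmonic (n + 1) ^ 2 := by
  refine hasSum_oddHarmonic_add_sq.summable.of_nonneg_of_le (fun n => by positivity) fun n => ?_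
  rw [div_pow, one_div_mul_eq_div]
  have := oddHarmonic_nonneg n
  have := oddHarmonic_nonneg (n + 1)
  gcongr
  linarith

/-! ### Reduction of the multiple sums to iterated sums -/

/-- Antitone pairs of odd numbers. -/
def oddPairEquiv : (Σ n : ℕ, Fin (n + 1)) ≃
    {f : Fin 2 → ℕ // Antitone f ∧ ∀ i, 0 < f i ∧ f i % 2 = 1 % 2} where
  toFun x := ⟨![2 * x.1 + 1, 2 * x.2 + 1], by
    have := x.2.2
    refine ⟨Fin.antitone_iff_succ_le.2 fun i => ?_, fun i => ?_⟩ <;> fin_cases i <;>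
      simp; omega⟩
  invFun f := ⟨f.1 0 / 2, ⟨f.1 1 / 2, by
    have := f.2.1 (show (0 : Fin 2) ≤ 1 by simp)
    omega⟩⟩
  left_inv := by
    rintro ⟨n, j, hj⟩
    have key : ∀ (n' j' : ℕ) (hj' : j' < n' + 1), n' = n → j' = j →
        (⟨n', j', hj'⟩ : Σ n : ℕ, Fin (n + 1)) = ⟨n, j, hj⟩ := by
      rintro _ _ _ rfl rfl
      rfl
    exact key _ _ _ (by simp; omega) (by simp; omega)
  right_inv := by
    rintro ⟨f, hf, ho⟩
    have h0 := ho 0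
    have h1 := ho 1
    refine Subtype.ext (funext fun i => ?_)
    fin_cases i <;> simp <;> omega

/-- Antitone triples of odd numbers. -/
def oddTripleEquiv : (Σ n : ℕ, Σ j : Fin (n + 1), Fin (j + 1)) ≃
    {f : Fin 3 → ℕ // Antitone f ∧ ∀ i, 0 < f i ∧ f i % 2 = 1 % 2} where
  toFun x := ⟨![2 * x.1 + 1, 2 * x.2.1 + 1, 2 * x.2.2 + 1], by
    have := x.2.1.2
    have := x.2.2.2
    refine ⟨Fin.antitone_iff_succ_le.2 fun i => ?_, fun i => ?_⟩ <;> fin_cases i <;>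
      simp <;> omega⟩
  invFun f := ⟨f.1 0 / 2, ⟨f.1 1 / 2, by
    have := f.2.1 (show (0 : Fin 3) ≤ 1 by simp)
    omega⟩, ⟨f.1 2 / 2, by
    have := f.2.1 (show (1 : Fin 3) ≤ 2 by decide)
    simp only
    omega⟩⟩
  left_inv := by
    rintro ⟨n, ⟨j, hj⟩, ⟨i, hi⟩⟩
    have key : ∀ (n' j' i' : ℕ) (hj' : j' < n' + 1) (hi' : i' < j' + 1),
        n' = n → j' = j → i' = i →
        (⟨n', ⟨j', hj'⟩, ⟨i', hi'⟩⟩ : Σ n : ℕ, Σ j : Fin (n + 1), Fin (j + 1)) =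
          ⟨n, ⟨j, hj⟩, ⟨i, hi⟩⟩ := by
      rintro _ _ _ _ _ rfl rfl rfl
      rfl
    exact key _ _ _ _ _ (by simp; omega) (by simp; omega) (by simp; omega)
  right_inv := by
    rintro ⟨f, hf, ho⟩
    have h0 := ho 0
    have h1 := ho 1
    have h2 := ho 2
    refine Subtype.ext (funext fun i => ?_)
    fin_cases i <;> simp <;> omega

/-- Odd natural numbers as functions on a one-point type. -/
def oddEquiv (P : (Fin 1 → ℕ) → Prop) (hP : ∀ f, P f) : ℕ ≃
    {f : Fin 1 → ℕ // P f ∧ ∀ i, 0 < f i ∧ f i % 2 = 1 % 2} where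
  toFun n := ⟨![2 * n + 1], hP _, fun i => by fin_cases i; simp⟩
  invFun f := f.1 0 / 2
  left_inv n := by simp; omega
  right_inv := by
    rintro ⟨f, hf, ho⟩
    have h0 := ho 0
    refine Subtype.ext (funext fun i => ?_)
    fin_cases i
    simp
    omega

lemma HasSum.sigma_fin {γ : ℕ → Type*} [∀ n, Fintype (γ n)] {f : (Σ n, γ n) → ℝ} {g : ℕ → ℝ}
    {s : ℝ} (hf : ∀ x, 0 ≤ f x) (hg : HasSum g s) (hfg : ∀ n, ∑ j, f ⟨n, j⟩ = g n) :
    HasSum f s := by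
  have hsum : Summable f := by
    rw [summable_sigma_of_nonneg hf]
    refine ⟨fun n => (hasSum_fintype _).summable, ?_⟩
    simp only [tsum_fintype, hfg]
    exact hg.summable
  have := hsum.hasSum.sigma fun n => hasSum_fintype fun j => f ⟨n, j⟩
  simp only [hfg] at this
  rw [hg.unique this]
  exact hsum.hasSum

lemma tsv_singleton {k : ℕ} {s : ℝ} (h : HasSum (fun n : ℕ => 1 / (2 * (n : ℝ) + 1) ^ k) s) :
    tsv 2 1 [k] = s := by
  refine HasSum.tsum_eq ?_
  refine (oddEquiv Antitone fun f => Subsingleton.antitone f).hasSum_iff.1 ?_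
  refine h.congr_both (fun n => ?_) rfl
  simp [oddEquiv]

lemma tv_singleton {k : ℕ} {s : ℝ} (h : HasSum (fun n : ℕ => 1 / (2 * (n : ℝ) + 1) ^ k) s) :
    tv 2 1 [k] = s := by
  refine HasSum.tsum_eq ?_
  refine (oddEquiv StrictAnti fun f => Subsingleton.strictAnti f).hasSum_iff.1 ?_
  refine h.congr_both (fun n => ?_) rfl
  simp [oddEquiv]

lemma tsv_pair {k l : ℕ} {s : ℝ} (h : HasSum (fun n : ℕ => 1 / (2 * (n : ℝ) + 1) ^ k *
      ∑ j ∈ Finset.range (n + 1), 1 / (2 * (j : ℝ) + 1) ^ l) s) :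
    tsv 2 1 [k, l] = s := by
  refine HasSum.tsum_eq (oddPairEquiv.hasSum_iff.1 ?_)
  refine HasSum.sigma_fin (fun x => Finset.prod_nonneg fun i _ => by positivity) h fun n => ?_
  rw [Finset.mul_sum, ← Fin.sum_univ_eq_sum_range
    (fun j => 1 / (2 * (n : ℝ) + 1) ^ k * (1 / (2 * (j : ℝ) + 1) ^ l))]
  refine Finset.sum_congr rfl fun j _ => ?_
  simp [oddPairEquiv, Fin.prod_univ_two, mul_comm]

lemma tsv_triple {k l p : ℕ} {s : ℝ} (h : HasSum (fun n : ℕ => 1 / (2 * (n : ℝ) + 1) ^ k *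
      ∑ j ∈ Finset.range (n + 1), 1 / (2 * (j : ℝ) + 1) ^ l *
        ∑ i ∈ Finset.range (j + 1), 1 / (2 * (i : ℝ) + 1) ^ p) s) :
    tsv 2 1 [k, l, p] = s := by
  refine HasSum.tsum_eq (oddTripleEquiv.hasSum_iff.1 ?_)
  refine HasSum.sigma_fin (fun x => Finset.prod_nonneg fun i _ => by positivity) h fun n => ?_
  rw [Fintype.sum_sigma, Finset.mul_sum, ← Fin.sum_univ_eq_sum_range
    (fun j => 1 / (2 * (n : ℝ) + 1) ^ k * (1 / (2 * (j : ℝ) + 1) ^ l *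
      ∑ i ∈ Finset.range (j + 1), 1 / (2 * (i : ℝ) + 1) ^ p))]
  refine Finset.sum_congr rfl fun j _ => ?_
  rw [← mul_assoc, Finset.mul_sum, ← Fin.sum_univ_eq_sum_range
    (fun i => 1 / (2 * (n : ℝ) + 1) ^ k * (1 / (2 * (j : ℝ) + 1) ^ l) *
      (1 / (2 * (i : ℝ) + 1) ^ p))]
  refine Finset.sum_congr rfl fun i _ => ?_
  simp [oddTripleEquiv, Fin.prod_univ_succ]
  ring

/-- Weighted sum formula in weight 4 for multiple t-star values:
`t*(4) - 2(t*(3,1) + t*(2,2)) + 4t*(2,1,1) = (2/3)t(2)² + 2t(2)log²2`. -/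
theorem stmt12 :
    tsv 2 1 [4] - 2 * (tsv 2 1 [3, 1] + tsv 2 1 [2, 2]) + 4 * tsv 2 1 [2, 1, 1] =
      2 / 3 * tv 2 1 [2] ^ 2 + 2 * tv 2 1 [2] * Real.log 2 ^ 2 := by
  have hO := summable_oddHarmonic_sq
  have h31 : Summable fun n : ℕ => 1 / (2 * (n : ℝ) + 1) ^ 3 *
      ∑ j ∈ Finset.range (n + 1), 1 / (2 * (j : ℝ) + 1) ^ 1 := by
    refine hO.of_nonneg_of_le (fun n => by positivity) fun n => ?_
    simp only [pow_one]
    change 1 / (2 * (n : ℝ) + 1) ^ 3 * oddHarmonic (n + 1) ≤ _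
    have h0 := oddHarmonic_nonneg n
    have h1 : 1 / (2 * (n : ℝ) + 1) ≤ oddHarmonic (n + 1) := by
      rw [oddHarmonic_succ]; linarith
    have h2 := oddHarmonic_nonneg (n + 1)
    calc _ = 1 / (2 * (n : ℝ) + 1) ^ 2 * (1 / (2 * (n : ℝ) + 1) * oddHarmonic (n + 1)) := by
          field_simp
      _ ≤ 1 / (2 * (n : ℝ) + 1) ^ 2 * (oddHarmonic (n + 1) * oddHarmonic (n + 1)) := by gcongr
      _ = _ := by ring
  have h22 : Summable fun n : ℕ => 1 / (2 * (n : ℝ) + 1) ^ 2 *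
      ∑ j ∈ Finset.range (n + 1), 1 / (2 * (j : ℝ) + 1) ^ 2 := by
    refine hO.of_nonneg_of_le (fun n => by positivity) fun n => ?_
    exact mul_le_mul_of_nonneg_left (sum_odd_sq_le _) (by positivity)
  have h211 := ((hO.hasSum.add h22.hasSum).div_const 2).congr_both
    (g := fun n : ℕ => 1 / (2 * (n : ℝ) + 1) ^ 2 *
      ∑ j ∈ Finset.range (n + 1), 1 / (2 * (j : ℝ) + 1) ^ 1 *
        ∑ i ∈ Finset.range (j + 1), 1 / (2 * (i : ℝ) + 1) ^ 1) (fun n => ?_) rfl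
  swap
  · simp only [pow_one]
    change _ * ∑ j ∈ Finset.range (n + 1), 1 / (2 * (j : ℝ) + 1) * oddHarmonic (j + 1) = _
    rw [sum_oddHarmonic_div]
    ring
  rw [tsv_singleton hasSum_odd_pow_four, tsv_pair h31.hasSum, tsv_pair h22.hasSum,
    tsv_triple h211, tv_singleton hasSum_odd_sq]
  have hfinal := (hO.hasSum.sub h31.hasSum).mul_left 4
  have hQ := hasSum_oddHarmonic_add_sq.sub hasSum_odd_pow_four
  have := hQ.unique (hfinal.congr_both (fun n => ?_) rfl)
  · linarith
  · simp only [pow_one]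
    change _ = 4 * (_ - 1 / (2 * (n : ℝ) + 1) ^ 3 * oddHarmonic (n + 1))
    rw [oddHarmonic_succ]
    field_simp
    ring
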